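/- arXiv:2408.17093 — 2 statements merged into one kernel-verified Lean document; each statement's English description precedes it below -/
import Mathlib

section
/- For all s ∈ [2, 4], the inequality φ₁(s) = −(s−1)·log(2^s − 1) + (s−2)·log(2^s + 1) − s·log(2 sin(π/(2s))) + log 6 ≥ 0 holds. -/
open Real

lemma sin_sq_mul_one_add_sq_div_four_le {x : ℝ} (hx0 : 0 ≤ x) (hx : x ≤ π) :
    sin x ^ 2 * (1 + x ^ 2 / 4) ≤ x ^ 2 := by
  have hc := cos_le_one_div_sqrt_sq_add_one (x := x / 2) (by linarith) (by linarith)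
  have hcos : 0 ≤ cos (x / 2) := cos_nonneg_of_mem_Icc ⟨by linarith, by linarith⟩
  have hc2 : cos (x / 2) ^ 2 * (1 + x ^ 2 / 4) ≤ 1 := by
    have h := pow_le_pow_left₀ hcos hc 2
    rw [div_pow, one_pow, sq_sqrt (by positivity), le_div_iff₀ (by positivity)] at h
    nlinarith
  have hs : sin (x / 2) ^ 2 ≤ (x / 2) ^ 2 := sin_sq_le_sq
  have hd : sin x = 2 * sin (x / 2) * cos (x / 2) := by
    rw [← sin_two_mul]; ring_nf
  rw [hd]
  have := mul_le_mul hs hc2 (by positivity) (by positivity)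
  nlinarith

lemma rational_bound {t v : ℝ} (ht0 : 0 ≤ t) (hv : v * (4 + 2.77 * t) = 1) :
    0.6932 * v * (2 + t) * (64 / 15) - 0.6931 ^ 2 * v * (2 + t) * (1 + t) * (1 + 2 * v)
      ≤ 1 + 0.616 / (2 + t) ^ 2 := by
  have hv' : v = 1 / (4 + 2.77 * t) := by field_simp; linarith
  subst hv'
  rw [← sub_nonneg]
  have : 1 + 0.616 / (2 + t) ^ 2
      - (0.6932 * (1 / (4 + 2.77 * t)) * (2 + t) * (64 / 15)
        - 0.6931 ^ 2 * (1 / (4 + 2.77 * t)) * (2 + t) * (1 + t) * (1 + 2 * (1 / (4 + 2.77 * t))))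
      = (((2 + t) ^ 2 + 0.616) * (4 + 2.77 * t) ^ 2
        - (2 + t) ^ 3 * (0.6932 * (64 / 15) * (4 + 2.77 * t)
          - 0.6931 ^ 2 * (1 + t) * (6 + 2.77 * t))) / ((2 + t) ^ 2 * (4 + 2.77 * t) ^ 2) := by
    field_simp
    ring
  rw [this]
  apply div_nonneg _ (by positivity)
  ring_nf
  positivity


lemma monotoneOn_Icc_of_hasDerivAt_nonneg {f f' : ℝ → ℝ} {a b : ℝ}
    (hf : ∀ x ∈ Set.Icc a b, HasDerivAt f (f' x) x) (hf' : ∀ x ∈ Set.Icc a b, 0 ≤ f' x) :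
    MonotoneOn f (Set.Icc a b) := by
  refine monotoneOn_of_deriv_nonneg (convex_Icc a b)
    (fun x hx ↦ (hf x hx).continuousAt.continuousWithinAt)
    (fun x hx ↦ (hf x (interior_subset hx)).differentiableAt.differentiableWithinAt) ?_
  intro x hx
  rw [(hf x (interior_subset hx)).deriv]
  exact hf' x (interior_subset hx)

/-- The function whose nonnegativity on `[2, 4]` is asserted. -/
noncomputable def phi (s : ℝ) : ℝ :=
  -(s - 1) * log ((2 : ℝ) ^ s - 1) + (s - 2) * log ((2 : ℝ) ^ s + 1)
      - s * log (2 * sin (π / (2 * s))) + log 6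

/-- The first derivative of `phi`. -/
noncomputable def phiDeriv (s : ℝ) : ℝ :=
  -log ((2 : ℝ) ^ s - 1) - (s - 1) * ((2 : ℝ) ^ s * log 2 / ((2 : ℝ) ^ s - 1))
    + log ((2 : ℝ) ^ s + 1) + (s - 2) * ((2 : ℝ) ^ s * log 2 / ((2 : ℝ) ^ s + 1))
    - log (2 * sin (π / (2 * s)))
    + π / (2 * s) * cos (π / (2 * s)) / sin (π / (2 * s))

/-- The second derivative of `phi`. -/
noncomputable def phiDerivTwo (s : ℝ) : ℝ :=
  -4 * (2 : ℝ) ^ s * log 2 / (((2 : ℝ) ^ s) ^ 2 - 1)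
    + (s - 1) * (2 : ℝ) ^ s * log 2 ^ 2 / ((2 : ℝ) ^ s - 1) ^ 2
    + (s - 2) * (2 : ℝ) ^ s * log 2 ^ 2 / ((2 : ℝ) ^ s + 1) ^ 2
    + (π / (2 * s)) ^ 2 / (s * sin (π / (2 * s)) ^ 2)

lemma four_le_two_rpow {s : ℝ} (hs : 2 ≤ s) : (4 : ℝ) ≤ 2 ^ s := by
  calc (4 : ℝ) = 2 ^ (2 : ℝ) := by norm_num
    _ ≤ 2 ^ s := rpow_le_rpow_of_exponent_le (by norm_num) hs

lemma sin_pi_div_two_mul_pos {s : ℝ} (hs : 2 ≤ s) : 0 < sin (π / (2 * s)) := by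
  apply sin_pos_of_pos_of_lt_pi (by positivity)
  exact div_lt_self pi_pos (by linarith)

lemma hasDerivAt_two_rpow (s : ℝ) :
    HasDerivAt (fun x : ℝ ↦ (2 : ℝ) ^ x) ((2 : ℝ) ^ s * log 2) s := by
  simpa using (hasStrictDerivAt_const_rpow (by norm_num : (0 : ℝ) < 2) s).hasDerivAt

lemma hasDerivAt_pi_div_two_mul {s : ℝ} (hs : s ≠ 0) :
    HasDerivAt (fun x : ℝ ↦ π / (2 * x)) (-(π / (2 * s)) / s) s := by
  have h := ((hasDerivAt_id s).const_mul 2).fun_inv (by simpa using hs) |>.const_mul π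
  refine (h.congr_deriv ?_).congr_of_eventuallyEq (.of_forall fun x ↦ by simp [div_eq_mul_inv])
  simp only [id]
  field_simp

lemma hasDerivAt_phi {s : ℝ} (hs : 2 ≤ s) : HasDerivAt phi (phiDeriv s) s := by
  have hp := four_le_two_rpow hs
  have hsin := sin_pi_div_two_mul_pos hs
  have h0 : s ≠ 0 := by linarith
  have hp1 : (2 : ℝ) ^ s - 1 ≠ 0 := by linarith
  have hp2 : (2 : ℝ) ^ s + 1 ≠ 0 := by linarith
  have hid := hasDerivAt_id' s
  have hpow := hasDerivAt_two_rpow s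
  have hθ := hasDerivAt_pi_div_two_mul h0
  have h := ((((hid.sub_const 1).fun_neg.fun_mul ((hpow.sub_const 1).log hp1)).fun_add
    ((hid.sub_const 2).fun_mul ((hpow.add_const 1).log hp2))).fun_sub
    (hid.fun_mul ((hθ.sin.const_mul 2).log (by positivity)))).add_const (log 6)
  refine h.congr_deriv ?_
  unfold phiDeriv
  generalize π / (2 * s) = θ at *
  field_simp
  ring

lemma hasDerivAt_phiDeriv {s : ℝ} (hs : 2 ≤ s) :
    HasDerivAt phiDeriv (phiDerivTwo s) s := by
  have hp := four_le_two_rpow hs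
  have hsin := sin_pi_div_two_mul_pos hs
  have h0 : s ≠ 0 := by linarith
  have hp1 : (2 : ℝ) ^ s - 1 ≠ 0 := by linarith
  have hp2 : (2 : ℝ) ^ s + 1 ≠ 0 := by linarith
  have hp3 : ((2 : ℝ) ^ s) ^ 2 - 1 ≠ 0 := by nlinarith
  have hid := hasDerivAt_id' s
  have hpow := hasDerivAt_two_rpow s
  have hθ := hasDerivAt_pi_div_two_mul h0
  have h := ((((((hpow.sub_const 1).log hp1).fun_neg.fun_sub
    ((hid.sub_const 1).fun_mul ((hpow.mul_const (log 2)).fun_div (hpow.sub_const 1) hp1))).fun_add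
    ((hpow.add_const 1).log hp2)).fun_add
    ((hid.sub_const 2).fun_mul ((hpow.mul_const (log 2)).fun_div (hpow.add_const 1) hp2))).fun_sub
    ((hθ.sin.const_mul 2).log (by positivity))).fun_add
    ((hθ.fun_mul hθ.cos).fun_div hθ.sin hsin.ne')
  refine h.congr_deriv ?_
  unfold phiDerivTwo
  have hsc := sin_sq_add_cos_sq (π / (2 * s))
  generalize π / (2 * s) = θ at *
  generalize (2 : ℝ) ^ s = p at *
  have hcos : cos θ ^ 2 = 1 - sin θ ^ 2 := by linarith
  have hfac : p ^ 2 - 1 = (p - 1) * (p + 1) := by ring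
  rw [hfac]
  field_simp
  ring_nf
  rw [hcos]
  ring

lemma two_rpow_inv_le {s : ℝ} (hs : 2 ≤ s) :
    ((2 : ℝ) ^ s)⁻¹ * (4 + 2.77 * (s - 2)) ≤ 1 := by
  have hL := log_two_gt_d9
  have hpow : (2 : ℝ) ^ s = 4 * exp (log 2 * (s - 2)) := by
    rw [← rpow_def_of_pos (by norm_num), rpow_sub (by norm_num)]
    norm_num
    ring
  have hexp := add_one_le_exp (log 2 * (s - 2))
  have hle : 4 + 2.77 * (s - 2) ≤ (2 : ℝ) ^ s := by nlinarith
  have hpos : (0 : ℝ) < 2 ^ s := by positivity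
  rwa [inv_mul_le_iff₀ hpos, mul_one]

lemma phiDerivTwo_nonneg {s : ℝ} (hs : s ∈ Set.Icc (2 : ℝ) 4) : 0 ≤ phiDerivTwo s := by
  obtain ⟨hs2, hs4⟩ := hs
  have hp := four_le_two_rpow hs2
  have hsin := sin_pi_div_two_mul_pos hs2
  have hL1 := log_two_gt_d9
  have hL2 := log_two_lt_d9
  have hu := two_rpow_inv_le hs2
  unfold phiDerivTwo
  set p := (2 : ℝ) ^ s
  set u := p⁻¹ with hu_def
  set L := log 2
  have hup : u * p = 1 := inv_mul_cancel₀ (by linarith)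
  have hu0 : 0 < u := by positivity
  have hu4 : u ≤ 1 / 4 := by nlinarith
  have hA : -(64 / 15) * u * L ≤ -4 * p * L / (p ^ 2 - 1) := by
    rw [le_div_iff₀ (by nlinarith)]
    have hpp : u * p ^ 2 = p := by rw [pow_two, ← mul_assoc, hup, one_mul]
    have : 0 ≤ L * (p - 16 * u) := mul_nonneg (by linarith) (by linarith)
    linear_combination (4 / 15 : ℝ) * this - (64 / 15) * L * hpp
  have hB : (s - 1) * L ^ 2 * (u * (1 + 2 * u)) ≤ (s - 1) * p * L ^ 2 / (p - 1) ^ 2 := by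
    have : u * (1 + 2 * u) ≤ p / (p - 1) ^ 2 := by
      have hpu : p = 1 / u := by simp [hu_def]
      rw [le_div_iff₀ (by nlinarith), hpu]
      have : u * (1 + 2 * u) * (1 / u - 1) ^ 2 = (1 - 3 * u ^ 2 + 2 * u ^ 3) / u := by
        field_simp
        ring
      rw [this]
      gcongr
      nlinarith [sq_nonneg u]
    calc _ ≤ (s - 1) * L ^ 2 * (p / (p - 1) ^ 2) :=
          mul_le_mul_of_nonneg_left this (mul_nonneg (by linarith) (sq_nonneg L))
      _ = _ := by ring
  have hC : 0 ≤ (s - 2) * p * L ^ 2 / (p + 1) ^ 2 := by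
    have : 0 ≤ s - 2 := by linarith
    positivity
  have hD : (1 + 0.616 / s ^ 2) / s ≤ (π / (2 * s)) ^ 2 / (s * sin (π / (2 * s)) ^ 2) := by
    have hx := sin_sq_mul_one_add_sq_div_four_le (x := π / (2 * s)) (by positivity)
      (div_le_self pi_pos.le (by linarith))
    have h1 : 1 + 0.616 / s ^ 2 ≤ 1 + (π / (2 * s)) ^ 2 / 4 := by
      have : (π / (2 * s)) ^ 2 / 4 = (π ^ 2 / 16) / s ^ 2 := by field_simp; ring
      rw [this]
      gcongr
      nlinarith [pi_gt_d2]
    rw [← div_div, div_right_comm]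
    gcongr
    rw [le_div_iff₀ (by positivity)]
    nlinarith [sq_nonneg (sin (π / (2 * s)))]
  set v := (4 + 2.77 * (s - 2))⁻¹ with hv_def
  have hden : 0 < 4 + 2.77 * (s - 2) := by linarith
  have hv : v * (4 + 2.77 * (s - 2)) = 1 := inv_mul_cancel₀ hden.ne'
  have huv : u ≤ v := by
    rw [hv_def, ← one_div, le_div_iff₀ hden]; exact hu
  have hR := rational_bound (t := s - 2) (by linarith) hv
  have hE : 64 / 15 * u * L - (s - 1) * L ^ 2 * (u * (1 + 2 * u))
      ≤ (1 + 0.616 / s ^ 2) / s := by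
    rw [le_div_iff₀ (by linarith)]
    have e : 2 + (s - 2) = s := by ring
    have e1 : 1 + (s - 2) = s - 1 := by ring
    rw [e, e1] at hR
    refine le_trans ?_ hR
    have h1 : 64 / 15 * u * L - (s - 1) * L ^ 2 * (u * (1 + 2 * u))
        ≤ 64 / 15 * u * 0.6932 - (s - 1) * 0.6931 ^ 2 * (u * (1 + 2 * u)) := by
      gcongr <;> linarith
    have hk : (s - 1) * v ≤ 0.32 := by
      rw [hv_def, ← div_eq_mul_inv, div_le_iff₀ hden]
      linarith
    have hk0 : (s - 1) * u ≤ 0.32 :=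
      (mul_le_mul_of_nonneg_left huv (by linarith)).trans hk
    have h2 : 64 / 15 * u * 0.6932 - (s - 1) * 0.6931 ^ 2 * (u * (1 + 2 * u))
        ≤ 64 / 15 * v * 0.6932 - (s - 1) * 0.6931 ^ 2 * (v * (1 + 2 * v)) := by
      have : 0 ≤ (v - u) * (64 / 15 * 0.6932
          - 0.6931 ^ 2 * ((s - 1) + 2 * ((s - 1) * u + (s - 1) * v))) :=
        mul_nonneg (by linarith) (by norm_num; linarith)
      linear_combination this
    calc _ ≤ (64 / 15 * v * 0.6932 - (s - 1) * 0.6931 ^ 2 * (v * (1 + 2 * v))) * s :=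
          mul_le_mul_of_nonneg_right (h1.trans h2) (by linarith)
      _ = _ := by ring
  linarith

lemma log_two_mul_sin_pi_div_four : log (2 * sin (π / (2 * 2))) = log 2 / 2 := by
  have h : (2 : ℝ) * sin (π / (2 * 2)) = √2 := by
    rw [show π / (2 * 2) = π / 4 by ring, sin_pi_div_four]
    ring
  rw [h, log_sqrt (by norm_num)]

lemma phi_two : phi 2 = 0 := by
  have h6 : log 6 = log 2 + log 3 := by
    rw [← log_mul (by norm_num) (by norm_num)]; norm_num
  unfold phi
  rw [log_two_mul_sin_pi_div_four, h6]
  norm_num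
  ring

lemma phiDeriv_two_nonneg : 0 ≤ phiDeriv 2 := by
  have h53 : 1 / 2 ≤ log 5 - log 3 := by
    rw [← log_div (by norm_num) (by norm_num), le_log_iff_exp_le (by norm_num)]
    have hsq : exp (1 / 2) ^ 2 = exp 1 := by rw [← exp_nat_mul]; norm_num
    refine (sq_le_sq₀ (exp_pos _).le (by norm_num)).mp ?_
    rw [hsq]
    linarith [exp_one_lt_d9]
  have hcot : π / (2 * 2) * cos (π / (2 * 2)) / sin (π / (2 * 2)) = π / 4 := by
    rw [show π / (2 * 2) = π / 4 by ring, cos_pi_div_four, sin_pi_div_four]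
    field_simp
  unfold phiDeriv
  rw [log_two_mul_sin_pi_div_four, hcot]
  norm_num
  linarith [pi_gt_d2, log_two_lt_d9]

theorem stmt_4 (s : ℝ) (hs : s ∈ Set.Icc (2 : ℝ) 4) :
    0 ≤ -(s - 1) * Real.log ((2 : ℝ) ^ s - 1) + (s - 2) * Real.log ((2 : ℝ) ^ s + 1)
      - s * Real.log (2 * Real.sin (Real.pi / (2 * s))) + Real.log 6 := by
  have h2 : (2 : ℝ) ∈ Set.Icc (2 : ℝ) 4 := by norm_num
  have hderiv : ∀ x ∈ Set.Icc (2 : ℝ) 4, 0 ≤ phiDeriv x := fun x hx ↦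
    phiDeriv_two_nonneg.trans <| monotoneOn_Icc_of_hasDerivAt_nonneg
      (fun y hy ↦ hasDerivAt_phiDeriv hy.1) (fun y hy ↦ phiDerivTwo_nonneg hy) h2 hx hx.1
  have hmono := monotoneOn_Icc_of_hasDerivAt_nonneg (fun y hy ↦ hasDerivAt_phi hy.1) hderiv
  exact phi_two.symm.le.trans (hmono h2 hs hs.1)
end

section
/- For all s ∈ [5/2, 4], the inequality φ(s) = −s·log 2 + log(9/4) − 2s·log(sin(π/(2s))) − 2(s−1)·log(cot(π/(2s))) − 2(s−1)·log((12s − 3)/(14(s−1))) ≥ 0 holds. -/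
theorem cos_le_taylor_four {x : ℝ} (hx : 0 ≤ x) :
    Real.cos x ≤ 1 - x ^ 2 / 2 + x ^ 4 / 24 := by
  have hderiv (y : ℝ) : HasDerivAt (fun y ↦ 1 - y ^ 2 / 2 + y ^ 4 / 24 - Real.cos y)
      (Real.sin y - (y - y ^ 3 / 6)) y := by
    have h := ((((hasDerivAt_id y).pow 2).div_const 2).const_sub 1).add
      (((hasDerivAt_id y).pow 4).div_const 24) |>.sub (Real.hasDerivAt_cos y)
    refine HasDerivAt.congr_deriv h ?_
    simp only [id]
    push_cast
    ring
  have hmono : MonotoneOn (fun y ↦ 1 - y ^ 2 / 2 + y ^ 4 / 24 - Real.cos y) (Set.Ici 0) := by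
    refine monotoneOn_of_deriv_nonneg (convex_Ici 0)
      (fun y _ ↦ (hderiv y).continuousAt.continuousWithinAt)
      (fun y _ ↦ (hderiv y).differentiableAt.differentiableWithinAt) fun y hy ↦ ?_
    rw [interior_Ici] at hy
    rw [(hderiv y).deriv]
    exact sub_nonneg.2 (Real.sin_ge_sub_cube (le_of_lt hy))
  have h := hmono Set.self_mem_Ici hx hx
  norm_num at h
  linarith

theorem sin_le_taylor_five {x : ℝ} (hx : 0 ≤ x) :
    Real.sin x ≤ x - x ^ 3 / 6 + x ^ 5 / 120 := by
  have hderiv (y : ℝ) : HasDerivAt (fun y ↦ y - y ^ 3 / 6 + y ^ 5 / 120 - Real.sin y)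
      (1 - y ^ 2 / 2 + y ^ 4 / 24 - Real.cos y) y := by
    have h := ((hasDerivAt_id y).sub (((hasDerivAt_id y).pow 3).div_const 6)).add
      (((hasDerivAt_id y).pow 5).div_const 120) |>.sub (Real.hasDerivAt_sin y)
    refine HasDerivAt.congr_deriv h ?_
    simp only [id]
    push_cast
    ring
  have hmono : MonotoneOn (fun y ↦ y - y ^ 3 / 6 + y ^ 5 / 120 - Real.sin y) (Set.Ici 0) := by
    refine monotoneOn_of_deriv_nonneg (convex_Ici 0)
      (fun y _ ↦ (hderiv y).continuousAt.continuousWithinAt)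
      (fun y _ ↦ (hderiv y).differentiableAt.differentiableWithinAt) fun y hy ↦ ?_
    rw [interior_Ici] at hy
    rw [(hderiv y).deriv]
    exact sub_nonneg.2 (cos_le_taylor_four (le_of_lt hy))
  have h := hmono Set.self_mem_Ici hx hx
  norm_num at h
  linarith

theorem log_add_le_log {c s : ℝ} (hc : 0 < c) (hcs : c ≤ s) :
    Real.log c + 2 * ((s - c) / (s + c)) + 2 / 3 * ((s - c) / (s + c)) ^ 3 ≤ Real.log s := by
  have hpos : 0 < s + c := by linarith
  have ht : 0 ≤ (s - c) / (s + c) := div_nonneg (by linarith) hpos.le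
  have ht1 : |(s - c) / (s + c)| < 1 := by
    rw [abs_of_nonneg ht, div_lt_one hpos]
    linarith
  have h := sum_le_hasSum (Finset.range 2) (fun k _ ↦ by positivity)
    (Real.hasSum_log_sub_log_of_abs_lt_one ht1)
  have h1 : 1 + (s - c) / (s + c) = 2 / (s + c) * s := by field_simp; ring
  have h2 : 1 - (s - c) / (s + c) = 2 / (s + c) * c := by field_simp; ring
  rw [h1, h2, Real.log_mul (by positivity) (by linarith), Real.log_mul (by positivity) hc.ne'] at h
  norm_num [Finset.sum_range_succ] at h
  linarith

theorem rational_lower_bound_nonneg {s : ℝ} (h₁ : 5 / 2 ≤ s) (h₂ : s ≤ 4) :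
    0 ≤ (2 - s) * 0.6932 + 4 * ((s - 2) / (s + 2)) + 4 / 3 * ((s - 2) / (s + 2)) ^ 3
      - 2 / 3 * 3.1416 * (1 - (3.1415 / (2 * s)) ^ 2 / 6 + (3.1415 / (2 * s)) ^ 4 / 120)
      - (1 - (3.1415 / (2 * s)) ^ 2 / 2 + (3.1415 / (2 * s)) ^ 4 / 24) * ((12 * s - 3) / 7)
      + 2 * s := by
  have hs : 0 < s := by linarith
  have hs2 : 0 < s + 2 := by linarith
  have ha : 0 ≤ s - 5 / 2 := by linarith
  have hb : 0 ≤ 4 - s := by linarith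
  have hterm (i j : ℕ) : 0 ≤ (s - 5 / 2) ^ i * (4 - s) ^ j := by positivity
  refine nonneg_of_mul_nonneg_left (b := s ^ 4 * (s + 2) ^ 3) ?_ (by positivity)
  field_simp
  linarith [hterm 0 8, hterm 1 7, hterm 2 6, hterm 3 5, hterm 4 4, hterm 5 3, hterm 6 2,
    hterm 7 1, hterm 8 0]

theorem stmt_17 (s : ℝ) (hs : s ∈ Set.Icc (5/2 : ℝ) 4) :
    0 ≤ -s * Real.log 2 + Real.log (9/4)
      - 2 * s * Real.log (Real.sin (Real.pi / (2 * s)))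
      - 2 * (s - 1) * Real.log (Real.cos (Real.pi / (2 * s)) / Real.sin (Real.pi / (2 * s)))
      - 2 * (s - 1) * Real.log ((12 * s - 3) / (14 * (s - 1))) := by
  obtain ⟨h₁, h₂⟩ := hs
  have hs0 : 0 < s := by linarith
  have hs1 : 0 < s - 1 := by linarith
  have hs3 : 0 < 12 * s - 3 := by linarith
  have hpi := Real.pi_pos
  have hpi_lo := Real.pi_gt_d4
  have hpi_hi := Real.pi_lt_d4
  set x := Real.pi / (2 * s) with hx
  have hx0 : 0 < x := by positivity
  have hsx : s * x = Real.pi / 2 := by rw [hx]; field_simp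
  have hx1 : x < 1 := by rw [hx, div_lt_one (by positivity)]; linarith
  have hsin : 0 < Real.sin x := Real.sin_pos_of_pos_of_lt_pi hx0 (by linarith)
  have hcos : 0 < Real.cos x := Real.cos_pos_of_mem_Ioo ⟨by linarith, by linarith⟩
  have hy : 3.1415 / (2 * s) ≤ x := by rw [hx]; gcongr
  have hpoly := rational_lower_bound_nonneg h₁ h₂
  set y := 3.1415 / (2 * s) with hydef
  have hy0 : 0 < y := by positivity
  clear_value x y
  have hsq : y ^ 2 ≤ x ^ 2 := by gcongr
  have hx2 : x ^ 2 ≤ 1 := by nlinarith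
  have hcos_le : Real.cos x ≤ 1 - y ^ 2 / 2 + y ^ 4 / 24 := by
    nlinarith [cos_le_taylor_four hx0.le]
  have hquot : 0 ≤ 1 - x ^ 2 / 6 + x ^ 4 / 120 := by nlinarith [pow_pos hx0 4]
  have hsin_le : s * Real.sin x ≤ 3.1416 / 2 * (1 - y ^ 2 / 6 + y ^ 4 / 120) := by
    calc s * Real.sin x ≤ s * (x - x ^ 3 / 6 + x ^ 5 / 120) := by
          gcongr; exact sin_le_taylor_five hx0.le
      _ = Real.pi / 2 * (1 - x ^ 2 / 6 + x ^ 4 / 120) := by rw [← hsx]; ring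
      _ ≤ 3.1416 / 2 * (1 - y ^ 2 / 6 + y ^ 4 / 120) := by
          gcongr ?_ / 2 * ?_
          nlinarith
  have hlog_sin : Real.log (2 / 3 * (s * Real.sin x)) ≤ 2 / 3 * (s * Real.sin x) - 1 :=
    Real.log_le_sub_one_of_pos (by positivity)
  have hlog_sin_eq : 2 * Real.log (2 / 3 * (s * Real.sin x)) =
      2 * Real.log s + 2 * Real.log (Real.sin x) - Real.log (9 / 4) := by
    rw [Real.log_mul (by norm_num) (by positivity), Real.log_mul hs0.ne' hsin.ne',
      show (9 / 4 : ℝ) = ((2 / 3)⁻¹) ^ 2 by norm_num, Real.log_pow, Real.log_inv]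
    push_cast
    ring
  have hlog_cos := Real.log_le_sub_one_of_pos
    (show 0 < Real.cos x * ((12 * s - 3) / (14 * (s - 1))) by positivity)
  rw [Real.log_mul hcos.ne' (by positivity)] at hlog_cos
  have hlog_cos_le : 2 * (s - 1) * (Real.log (Real.cos x) +
      Real.log ((12 * s - 3) / (14 * (s - 1)))) ≤
      (1 - y ^ 2 / 2 + y ^ 4 / 24) * ((12 * s - 3) / 7) - 2 * (s - 1) := by
    calc _ ≤ 2 * (s - 1) * (Real.cos x * ((12 * s - 3) / (14 * (s - 1))) - 1) := by gcongr
      _ = Real.cos x * ((12 * s - 3) / 7) - 2 * (s - 1) := by field_simp; ring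
      _ ≤ _ := by gcongr
  have hlog_s := log_add_le_log two_pos (show 2 ≤ s by linarith)
  have hlog_two : (s - 2) * Real.log 2 ≤ (s - 2) * 0.6932 := by
    gcongr
    · linarith
    · linarith [Real.log_two_lt_d9]
  rw [Real.log_div hcos.ne' hsin.ne']
  linarith
end
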